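/- Let G be a finite simple graph, S ⊆ V a connected set, B a block of G[S], and (lb, rb) an ordered CCP-pair of B. Then grow(lb, S \ rb) and grow(rb, S \ lb) are disjoint and their union is S; equivalently, S \ grow(lb, S \ rb) = grow(rb, S \ lb). -/

import Mathlib

open SimpleGraph

variable {V : Type*}

/-- `(Sl, Sr)` is an ordered CCP-pair of `S` in graph `G`. -/
def CCP (G : SimpleGraph V) (S Sl Sr : Set V) : Prop :=
  Sl.Nonempty ∧ Sr.Nonempty ∧ Sl ∩ Sr = ∅ ∧ Sl ∪ Sr = S ∧
  (G.induce Sl).Connected ∧ (G.induce Sr).Connected ∧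
  ∃ a ∈ Sl, ∃ b ∈ Sr, G.Adj a b

/-- `B` is a block (maximal nonseparable subgraph) of `G[S]`. -/
def IsBlock (G : SimpleGraph V) (S B : Set V) : Prop :=
  B ⊆ S ∧ 2 ≤ B.ncard ∧ (G.induce B).Connected ∧
  (∀ v ∈ B, (G.induce (B \ {v})).Connected) ∧
  ∀ B' : Set V, B ⊆ B' → B' ⊆ S → 2 ≤ B'.ncard → (G.induce B').Connected →
    (∀ v ∈ B', (G.induce (B' \ {v})).Connected) → B' = B

/-- `grow G X Y` is the set of vertices of `Y` reachable in `G[Y]` from some vertex of `X`. -/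
def grow (G : SimpleGraph V) (X Y : Set V) : Set V :=
  {y | ∃ hy : y ∈ Y, ∃ x, ∃ hx : x ∈ Y, x ∈ X ∧ (G.induce Y).Reachable ⟨x, hx⟩ ⟨y, hy⟩}

/-- If a predicate is preserved by the steps of a walk whose targets lie on the walk, it passes
from the first vertex to the whole support. -/
lemma SimpleGraph.Walk.forall_mem_support_of_adj {G : SimpleGraph V} {P : V → Prop} {u v : V}
    (p : G.Walk u v) (hu : P u) (hP : ∀ x y, y ∈ p.support → P x → G.Adj x y → P y) :
    ∀ w ∈ p.support, P w := by
  induction p with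
  | nil => simpa using hu
  | cons h q ih =>
    have hq := ih (hP _ _ (by simp) hu h) fun x y hy => hP x y (by simp [hy])
    simpa using And.intro hu hq

/-- Adding a path with both endpoints in a connected set, at least one of them surviving the
deletion of any vertex, keeps the set connected after that deletion. -/
lemma connected_induce_union_support_diff {G : SimpleGraph V} {B : Set V} {a b : V}
    (ha : a ∈ B) (hb : b ∈ B) {p : G.Walk a b} (hp : p.IsPath) (v : V)
    (hv : (G.induce (B \ {v})).Connected) :
    (G.induce ((B ∪ {w | w ∈ p.support}) \ {v})).Connected := by
  obtain ⟨⟨u, hu⟩⟩ := hv.nonempty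
  have patch : ∀ {w c : V} (q : G.Walk c w), c ∈ B → v ∉ q.support →
      (∀ x ∈ q.support, x ∈ p.support) → ∃ s' ⊆ (B ∪ {w | w ∈ p.support}) \ {v},
        ∃ (hu' : u ∈ s') (hw' : w ∈ s'), (G.induce s').Reachable ⟨u, hu'⟩ ⟨w, hw'⟩ := by
    intro w c q hc hvq hq
    have hcv : c ≠ v := fun h => hvq (h ▸ q.start_mem_support)
    refine ⟨(B \ {v}) ∪ {x | x ∈ q.support}, ?_, Or.inl hu, Or.inr q.end_mem_support,
      (induce_union_connected hv.preconnected q.connected_induce_support.preconnected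
        ⟨c, ⟨hc, hcv⟩, q.start_mem_support⟩).preconnected _ _⟩
    rintro x (hx | hx)
    · exact ⟨Or.inl hx.1, hx.2⟩
    · exact ⟨Or.inr (hq x hx), fun h => hvq (h ▸ hx)⟩
  refine induce_connected_of_patches u ⟨Or.inl hu.1, hu.2⟩ ?_
  rintro w ⟨hw | hw, hwv⟩
  · exact ⟨B \ {v}, Set.sdiff_subset_sdiff_left Set.subset_union_left, hu, ⟨hw, hwv⟩,
      hv.preconnected _ _⟩
  · obtain ⟨q, r, -, -, rfl⟩ := hp.mem_support_iff_exists_append.1 hw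
    by_cases hq : v ∈ q.support
    · have hr : v ∉ r.support := fun hr =>
        hp.ne_of_mem_support_of_append (fun h => hwv h.symm) hq hr rfl
      exact patch r.reverse hb (by simpa using hr) (by simp +contextual)
    · exact patch q ha hq (by simp +contextual)

/-- A path in `G[S]` between two vertices of a block of `G[S]` stays in the block. -/
lemma IsBlock.support_subset [Finite V] {G : SimpleGraph V} {S B : Set V} (hB : IsBlock G S B)
    {a b : V} (ha : a ∈ B) (hb : b ∈ B) {p : G.Walk a b} (hp : p.IsPath)
    (hS : ∀ w ∈ p.support, w ∈ S) : ∀ w ∈ p.support, w ∈ B := by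
  obtain ⟨hBS, hcard, hconn, hdel, hmax⟩ := hB
  have hdel' : ∀ v, (G.induce (B \ {v})).Connected := fun v => by
    by_cases hv : v ∈ B
    · exact hdel v hv
    · rwa [Set.sdiff_singleton_eq_self hv]
  have h := hmax (B ∪ {w | w ∈ p.support}) Set.subset_union_left (Set.union_subset hBS hS)
    (hcard.trans (Set.ncard_le_ncard Set.subset_union_left (Set.toFinite _)))
    (induce_union_connected hconn.preconnected p.connected_induce_support.preconnected
      ⟨a, ha, p.start_mem_support⟩)
    fun v _ => connected_induce_union_support_diff ha hb hp v (hdel' v)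
  exact Set.union_eq_left.1 h

lemma subset_grow {G : SimpleGraph V} {X Y : Set V} (h : X ⊆ Y) : X ⊆ grow G X Y :=
  fun x hx => ⟨h hx, x, h hx, hx, Reachable.rfl⟩

lemma mem_grow_of_adj {G : SimpleGraph V} {X Y : Set V} {x y : V} (hx : x ∈ grow G X Y)
    (hy : y ∈ Y) (h : G.Adj x y) : y ∈ grow G X Y := by
  obtain ⟨hxY, z, hz, hzX, hr⟩ := hx
  have hxy : (G.induce Y).Adj ⟨x, hxY⟩ ⟨y, hy⟩ := h
  exact ⟨hy, z, hz, hzX, hr.trans hxy.reachable⟩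

/-- Growing the two sides of a partition of a nonempty `B ⊆ S`, each avoiding the other, exhausts a
connected `S`. -/
lemma grow_union_grow {G : SimpleGraph V} {S X Y : Set V} (hconn : (G.induce S).Connected)
    (hXS : X ⊆ S) (hYS : Y ⊆ S) (hXY : Disjoint X Y) (hX : X.Nonempty) :
    grow G X (S \ Y) ∪ grow G Y (S \ X) = S := by
  have hX' : X ⊆ grow G X (S \ Y) := subset_grow (Set.subset_sdiff.2 ⟨hXS, hXY⟩)
  have hY' : Y ⊆ grow G Y (S \ X) := subset_grow (Set.subset_sdiff.2 ⟨hYS, hXY.symm⟩)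
  refine Set.Subset.antisymm ?_ fun y hy => ?_
  · rintro y (⟨hy, -⟩ | ⟨hy, -⟩) <;> exact hy.1
  · obtain ⟨x, hx⟩ := hX
    obtain ⟨p⟩ := hconn.preconnected ⟨x, hXS hx⟩ ⟨y, hy⟩
    have key := p.forall_mem_support_of_adj
      (P := fun z : S => (z : V) ∈ grow G X (S \ Y) ∪ grow G Y (S \ X)) (Or.inl (hX' hx))
    refine key ?_ ⟨y, hy⟩ p.end_mem_support
    rintro u w - hu huw
    by_cases hwX : (w : V) ∈ X
    · exact Or.inl (hX' hwX)
    by_cases hwY : (w : V) ∈ Y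
    · exact Or.inr (hY' hwY)
    exact hu.imp (fun h => mem_grow_of_adj h ⟨w.2, hwY⟩ huw)
      fun h => mem_grow_of_adj h ⟨w.2, hwX⟩ huw

/-- Growing the two sides of a partition of a block of `G[S]`, each avoiding the other, yields
disjoint sets. -/
lemma IsBlock.disjoint_grow [Finite V] {G : SimpleGraph V} {S X Y : Set V}
    (hB : IsBlock G S (X ∪ Y)) (hXY : Disjoint X Y) :
    Disjoint (grow G X (S \ Y)) (grow G Y (S \ X)) := by
  rw [Set.disjoint_left]
  rintro z ⟨hz, x, hx, hxX, hxz⟩ ⟨hz', y, hy, hyY, hyz⟩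
  let H : SimpleGraph V :=
    { Adj := fun u w => G.Adj u w ∧ (u ∈ S \ Y ∧ w ∈ S \ Y ∨ u ∈ S \ X ∧ w ∈ S \ X)
      symm := ⟨fun _ _ h => ⟨h.1.symm, h.2.imp And.symm And.symm⟩⟩
      loopless := ⟨fun _ h => h.1.ne rfl⟩ }
  have hHG : H ≤ G := fun _ _ h => h.1
  let fX : G.induce (S \ Y) →g H := ⟨Subtype.val, fun {u w} h => ⟨h, Or.inl ⟨u.2, w.2⟩⟩⟩
  let fY : G.induce (S \ X) →g H := ⟨Subtype.val, fun {u w} h => ⟨h, Or.inr ⟨u.2, w.2⟩⟩⟩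
  have hxy : H.Reachable x y := (hxz.map fX).trans (hyz.map fY).symm
  obtain ⟨p, hp⟩ := hxy.exists_isPath
  have hpS : ∀ w ∈ p.support, w ∈ S := p.forall_mem_support_of_adj hx.1 fun _ _ _ _ h =>
    h.2.elim (fun h => h.2.1) fun h => h.2.1
  have hpB : ∀ w ∈ p.support, w ∈ X ∪ Y := by
    have := hB.support_subset (Or.inl hxX) (Or.inr hyY) (hp.mapLe hHG) (by simpa using hpS)
    simpa using this
  have hpX : ∀ w ∈ p.support, w ∈ X := p.forall_mem_support_of_adj hxX fun u w hw hu h =>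
    (hpB w hw).resolve_right fun hwY => h.2.elim (fun h => h.2.2 hwY) fun h => h.1.2 hu
  exact Set.disjoint_left.1 hXY (hpX y p.end_mem_support) hyY

/-- If `S` is connected, `B` is a block of `G[S]`, and `(lb, rb)` is an
ordered CCP-pair of `B`, then `grow(lb, S \ rb)` and `grow(rb, S \ lb)` are disjoint with
union `S`; equivalently `S \ grow(lb, S \ rb) = grow(rb, S \ lb)`. -/
theorem stmt7 [Fintype V] (G : SimpleGraph V) (S B lb rb : Set V)
    (hconn : (G.induce S).Connected) (hB : IsBlock G S B)
    (hpair : CCP G B lb rb) :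
    grow G lb (S \ rb) ∩ grow G rb (S \ lb) = ∅ ∧
    grow G lb (S \ rb) ∪ grow G rb (S \ lb) = S ∧
    S \ grow G lb (S \ rb) = grow G rb (S \ lb) := by
  obtain ⟨hl, -, hdisj, rfl, -⟩ := hpair
  rw [← Set.disjoint_iff_inter_eq_empty] at hdisj
  have hd := hB.disjoint_grow hdisj
  have hu := grow_union_grow hconn (Set.subset_union_left.trans hB.1)
    (Set.subset_union_right.trans hB.1) hdisj hl
  refine ⟨hd.inter_eq, hu, ?_⟩
  nth_rewrite 1 [← hu]
  rw [Set.union_sdiff_left, hd.symm.sdiff_eq_left]
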